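/- arXiv:1410.8726 — 2 statements merged into one kernel-verified Lean document; each statement's English description precedes it below -/
import Mathlib

section
/- Let n ≥ 2, let H ≤ S_n be semiregular, let R be an orbit transversal of the natural action of H on {1,…,n}, and let G ≤ N_{S_n}(H) ∩ Stab_{S_n}(R), where Stab_{S_n}(R) is the setwise stabilizer of R. Then the set HG = {hg : h ∈ H, g ∈ G} is a subgroup of S_n, and V_n(HG) is isomorphic to V_n(G) as abstract groups. -/
open scoped Classical Pointwise

/-- The group of self-homeomorphisms of a topological space, with
`(f * g) x = f (g x)`. -/
instance homeoGroup (X : Type*) [TopologicalSpace X] : Group (X ≃ₜ X) where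
  mul a b := b.trans a
  one := Homeomorph.refl X
  inv := Homeomorph.symm
  mul_assoc a b c := Homeomorph.ext fun _ => rfl
  one_mul a := Homeomorph.ext fun _ => rfl
  mul_one a := Homeomorph.ext fun _ => rfl
  inv_mul_cancel a := Homeomorph.ext fun x => a.symm_apply_apply x

/-- The `n`-ary Cantor space: infinite sequences over an `n`-letter alphabet. -/
abbrev Cantor (n : ℕ) := ℕ → Fin n

/-- Prefix a sequence by a finite word. -/
def appendWord {n : ℕ} (θ : List (Fin n)) (x : Cantor n) : Cantor n :=
  fun i => if h : i < θ.length then θ.get ⟨i, h⟩ else x (i - θ.length)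

/-- `x` lies in the cone `[θ]`, i.e. has `θ` as a prefix. -/
def inCone {n : ℕ} (θ : List (Fin n)) (x : Cantor n) : Prop :=
  ∀ i, (h : i < θ.length) → x i = θ.get ⟨i, h⟩

/-- A map is a prefix-substitution map if it is given by two partitions of the
Cantor space into cones `[α i]` resp. `[β i]`, replacing the prefix `α i` by `β i`. -/
def IsPrefixMap {n : ℕ} (v : Cantor n → Cantor n) : Prop :=
  ∃ (t : ℕ) (α β : Fin t → List (Fin n)),
    (∀ x : Cantor n, ∃! i, inCone (α i) x) ∧
    (∀ x : Cantor n, ∃! i, inCone (β i) x) ∧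
    ∀ (i : Fin t) (γ : Cantor n), v (appendWord (α i) γ) = appendWord (β i) γ

/-- The Higman–Thompson group `V_n`, as a subgroup of the homeomorphism group of
the `n`-ary Cantor space: the group of all prefix-substitution homeomorphisms. -/
def HigmanThompson (n : ℕ) : Subgroup (Cantor n ≃ₜ Cantor n) :=
  Subgroup.closure {v | IsPrefixMap ⇑v}

/-- The iterated permutation `[α]_g` (as a function): identity outside the cone
`[α]`, and applying `g` to every letter after the prefix `α` inside it.
With `α = []` this is `[∅]_g`, applying `g` to every letter. -/
noncomputable def iterPermFun {n : ℕ} (α : List (Fin n)) (g : Equiv.Perm (Fin n))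
    (x : Cantor n) : Cantor n :=
  if inCone α x then fun i => if i < α.length then x i else g (x i) else x

/-- The group `V_n(G)`: the subgroup of the homeomorphism group of the `n`-ary
Cantor space generated by `V_n` together with all iterated permutations `[α]_g`
for `g ∈ G` and finite words `α`. -/
def VnG (n : ℕ) (G : Subgroup (Equiv.Perm (Fin n))) : Subgroup (Cantor n ≃ₜ Cantor n) :=
  Subgroup.closure
    ({v | IsPrefixMap ⇑v} ∪
      {v | ∃ (α : List (Fin n)) (g : Equiv.Perm (Fin n)), g ∈ G ∧ ⇑v = iterPermFun α g})

/-- A permutation group is semiregular if no nontrivial element has a fixed point. -/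
def Semiregular {n : ℕ} (G : Subgroup (Equiv.Perm (Fin n))) : Prop :=
  ∀ g ∈ G, (∃ x, g x = x) → g = 1

/-- `R` is an orbit transversal for the natural action of `H ≤ S_n` on the `n`
points: it contains exactly one point of each `H`-orbit. -/
def IsTransversal {n : ℕ} (H : Subgroup (Equiv.Perm (Fin n))) (R : Set (Fin n)) : Prop :=
  ∀ x : Fin n, ∃! r, r ∈ R ∧ ∃ h ∈ H, h x = r

/-- Apply the homeomorphism product pointwise. -/
theorem hmul_apply {X : Type*} [TopologicalSpace X] (f g : X ≃ₜ X) (x : X) :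
    (f * g) x = f (g x) := rfl

theorem hinv_apply_self {X : Type*} [TopologicalSpace X] (f : X ≃ₜ X) (x : X) :
    (f⁻¹) (f x) = x := f.symm_apply_apply x

theorem happly_inv_self {X : Type*} [TopologicalSpace X] (f : X ≃ₜ X) (x : X) :
    f ((f⁻¹) x) = x := f.apply_symm_apply x

/-- Two sequences agree on the first `N` letters. -/
def Agree {n : ℕ} (N : ℕ) (x y : Cantor n) : Prop := ∀ i, i < N → y i = x i

/-- Local form of a map near `x`: replace a prefix of length `N` by one of length `M`
and apply `k` to all later letters. -/
def LocAt {n : ℕ} (v : Cantor n → Cantor n) (x : Cantor n) (N M : ℕ)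
    (k : Equiv.Perm (Fin n)) : Prop :=
  ∀ y, Agree N x y → Agree M (v x) (v y) ∧ ∀ i, v y (M + i) = k (y (N + i))

theorem LocAt.shift {n : ℕ} {v : Cantor n → Cantor n} {x : Cantor n} {N M : ℕ}
    {k : Equiv.Perm (Fin n)} (h : LocAt v x N M k) (d : ℕ) :
    LocAt v x (N + d) (M + d) k := by
  intro y hy
  obtain ⟨h1, h2⟩ := h y (fun i hi => hy i (by omega))
  obtain ⟨_, h3⟩ := h x (fun i hi => rfl)
  refine ⟨fun i hi => ?_, fun i => ?_⟩
  · by_cases hiM : i < M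
    · exact h1 i hiM
    · obtain ⟨j, rfl⟩ := Nat.exists_eq_add_of_le (not_lt.mp hiM)
      rw [h2, h3, hy _ (by omega)]
  · rw [add_assoc, h2, add_assoc]

/-- Locally in `K`. -/
def Loc {n : ℕ} (K : Subgroup (Equiv.Perm (Fin n))) (v : Cantor n → Cantor n) : Prop :=
  ∀ x, ∃ N M k, k ∈ K ∧ LocAt v x N M k

theorem Loc.mul {n : ℕ} {K : Subgroup (Equiv.Perm (Fin n))} {v w : Cantor n ≃ₜ Cantor n}
    (hv : Loc K v) (hw : Loc K w) : Loc K (v * w : Cantor n ≃ₜ Cantor n) := by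
  intro x
  obtain ⟨N, M, k, hk, h⟩ := hw x
  obtain ⟨N', M', k', hk', h'⟩ := hv (w x)
  have h1 := h.shift N'
  have h2 := h'.shift M
  rw [add_comm N' M] at h2
  refine ⟨N + N', M' + M, k' * k, K.mul_mem hk' hk, ?_⟩
  intro y hy
  obtain ⟨a1, a2⟩ := h1 y hy
  obtain ⟨b1, b2⟩ := h2 (w y) a1
  refine ⟨b1, fun i => ?_⟩
  rw [hmul_apply, b2, a2]; rfl

theorem Loc.inv {n : ℕ} {K : Subgroup (Equiv.Perm (Fin n))} {v : Cantor n ≃ₜ Cantor n}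
    (hv : Loc K v) : Loc K (v⁻¹ : Cantor n ≃ₜ Cantor n) := by
  intro z
  obtain ⟨N, M, k, hk, h⟩ := hv (v⁻¹ z)
  refine ⟨M, N, k⁻¹, K.inv_mem hk, ?_⟩
  intro y' hy'
  set x := v⁻¹ z with hx
  have hvx : v x = z := happly_inv_self v z
  let y : Cantor n := fun i => if i < N then x i else k⁻¹ (y' (M + (i - N)))
  have hyA : Agree N x y := fun i hi => by simp [y, hi]
  obtain ⟨a1, a2⟩ := h y hyA
  have hyT : ∀ i, y (N + i) = k⁻¹ (y' (M + i)) := fun i => by simp [y]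
  have hvy : v y = y' := by
    funext i
    by_cases hiM : i < M
    · rw [a1 i hiM, hvx, hy' i hiM]
    · obtain ⟨j, rfl⟩ := Nat.exists_eq_add_of_le (not_lt.mp hiM)
      rw [a2, hyT]; simp
  have hvy' : v⁻¹ y' = y := by rw [← hvy]; exact hinv_apply_self v y
  rw [hvy']
  exact ⟨hyA, hyT⟩

theorem appendWord_add {n : ℕ} (θ : List (Fin n)) (x : Cantor n) (i : ℕ) :
    appendWord θ x (θ.length + i) = x i := by
  simp [appendWord]

theorem inCone_appendWord {n : ℕ} (θ : List (Fin n)) (x : Cantor n) :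
    inCone θ (appendWord θ x) := by
  intro i h; simp [appendWord, h]

theorem eq_appendWord {n : ℕ} {θ : List (Fin n)} {x : Cantor n} (h : inCone θ x) :
    x = appendWord θ (fun i => x (θ.length + i)) := by
  funext i
  by_cases hi : i < θ.length
  · rw [h i hi, inCone_appendWord _ _ i hi]
  · obtain ⟨j, rfl⟩ := Nat.exists_eq_add_of_le (not_lt.mp hi)
    rw [appendWord_add]

theorem inCone_of_agree {n : ℕ} {θ : List (Fin n)} {x y : Cantor n} (h : inCone θ x)
    (hy : Agree θ.length x y) : inCone θ y := fun i hi => by rw [hy i hi, h i hi]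

theorem loc_prefixMap {n : ℕ} (K : Subgroup (Equiv.Perm (Fin n))) {v : Cantor n → Cantor n}
    (hv : IsPrefixMap v) : Loc K v := by
  obtain ⟨t, α, β, hα, hβ, h⟩ := hv
  intro x
  obtain ⟨i, hi, -⟩ := hα x
  refine ⟨(α i).length, (β i).length, 1, K.one_mem, ?_⟩
  have key : ∀ y, inCone (α i) y → v y = appendWord (β i) (fun j => y ((α i).length + j)) := by
    intro y hy
    conv_lhs => rw [eq_appendWord hy]
    rw [h]
  intro y hy
  have hy' := inCone_of_agree hi hy
  rw [key x hi, key y hy']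
  refine ⟨fun j hj => ?_, fun j => ?_⟩
  · rw [inCone_appendWord _ _ j hj, inCone_appendWord _ _ j hj]
  · rw [appendWord_add]; rfl

theorem loc_iter {n : ℕ} (K : Subgroup (Equiv.Perm (Fin n))) (α : List (Fin n))
    {g : Equiv.Perm (Fin n)} (hg : g ∈ K) : Loc K (iterPermFun α g) := by
  intro x
  by_cases hx : inCone α x
  · refine ⟨α.length, α.length, g, hg, fun y hy => ?_⟩
    have hy' := inCone_of_agree hx hy
    refine ⟨fun j hj => ?_, fun j => ?_⟩
    · simp [iterPermFun, hx, hy', hj, hy j hj]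
    · simp [iterPermFun, hy']
  · refine ⟨α.length, α.length, 1, K.one_mem, fun y hy => ?_⟩
    have hy' : ¬ inCone α y := fun h => hx (inCone_of_agree h fun i hi => (hy i hi).symm)
    refine ⟨fun j hj => ?_, fun j => ?_⟩
    · simp [iterPermFun, hx, hy', hy j hj]
    · simp [iterPermFun, hy']

theorem loc_of_mem {n : ℕ} {K : Subgroup (Equiv.Perm (Fin n))} {v : Cantor n ≃ₜ Cantor n}
    (hv : v ∈ VnG n K) : Loc K v := by
  induction hv using Subgroup.closure_induction with
  | mem x hx =>
    rcases hx with hx | ⟨α, g, hg, hx⟩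
    · exact loc_prefixMap K hx
    · rw [hx]; exact loc_iter K α hg
  | one => exact fun x => ⟨0, 0, 1, K.one_mem, fun y _ => ⟨fun i hi => by omega, fun i => rfl⟩⟩
  | mul x y _ _ hx hy => exact hx.mul hy
  | inv x _ hx => exact hx.inv

theorem isClopen_inCone {n : ℕ} (α : List (Fin n)) : IsClopen {x : Cantor n | inCone α x} := by
  have : {x : Cantor n | inCone α x} =
      ⋂ i : Fin α.length, (fun x : Cantor n => x i) ⁻¹' {α.get i} := by
    ext x
    simp only [Set.mem_ofPred_eq, Set.mem_iInter, Set.mem_preimage, Set.mem_singleton_iff]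
    exact ⟨fun h i => h i i.2, fun h i hi => h ⟨i, hi⟩⟩
  rw [this]
  exact isClopen_iInter_of_finite fun i =>
    (isClopen_discrete _).preimage (continuous_apply _)

theorem continuous_iter {n : ℕ} (α : List (Fin n)) (g : Equiv.Perm (Fin n)) :
    Continuous (iterPermFun α g) := by
  unfold iterPermFun
  refine Continuous.if ?_ ?_ continuous_id
  · intro a ha
    rw [(isClopen_inCone α).frontier_eq] at ha
    exact ha.elim
  · refine continuous_pi fun i => ?_
    by_cases hi : i < α.length
    · simp only [hi, if_true]; exact continuous_apply i
    · simp only [hi, if_false]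
      exact continuous_of_discreteTopology.comp (continuous_apply i)

theorem iter_append {n : ℕ} (α : List (Fin n)) (g : Equiv.Perm (Fin n)) (γ : Cantor n) :
    iterPermFun α g (appendWord α γ) = appendWord α (fun i => g (γ i)) := by
  funext i
  rw [iterPermFun, if_pos (inCone_appendWord _ _)]
  by_cases hi : i < α.length
  · simp [appendWord, hi]
  · simp [appendWord, hi]

theorem iter_not {n : ℕ} (α : List (Fin n)) (g : Equiv.Perm (Fin n)) {x : Cantor n}
    (h : ¬ inCone α x) : iterPermFun α g x = x := by
  rw [iterPermFun, if_neg h]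

theorem iter_iter {n : ℕ} (α : List (Fin n)) (g g' : Equiv.Perm (Fin n)) (hg : g * g' = 1)
    (x : Cantor n) :
    iterPermFun α g (iterPermFun α g' x) = x := by
  by_cases h : inCone α x
  · rw [eq_appendWord h, iter_append, iter_append]
    congr 1
    funext i
    change (g * g') _ = _
    rw [hg]; rfl
  · rw [iter_not α g' h, iter_not α g h]

/-- `[α]_g` as a homeomorphism. -/
noncomputable def iterHomeo {n : ℕ} (α : List (Fin n)) (g : Equiv.Perm (Fin n)) :
    Cantor n ≃ₜ Cantor n where
  toFun := iterPermFun α g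
  invFun := iterPermFun α g⁻¹
  left_inv := iter_iter α _ _ (by simp)
  right_inv := iter_iter α _ _ (by simp)
  continuous_toFun := continuous_iter _ _
  continuous_invFun := continuous_iter _ _

theorem mem_of_table {n : ℕ} {K : Subgroup (Equiv.Perm (Fin n))} {t : ℕ}
    (α β : Fin t → List (Fin n))
    (hα : ∀ x : Cantor n, ∃! i, inCone (α i) x)
    (hβ : ∀ x : Cantor n, ∃! i, inCone (β i) x) (S : Finset (Fin t)) :
    ∀ (k : Fin t → Equiv.Perm (Fin n)), (∀ i, k i ∈ K) → (∀ i, i ∉ S → k i = 1) →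
    ∀ v : Cantor n ≃ₜ Cantor n,
      (∀ i γ, v (appendWord (α i) γ) = appendWord (β i) (fun j => k i (γ j))) →
      v ∈ VnG n K := by
  induction S using Finset.induction_on with
  | empty =>
    intro k hk hS v hv
    refine Subgroup.subset_closure (Or.inl ⟨t, α, β, hα, hβ, fun i γ => ?_⟩)
    rw [hv, hS i (by simp)]; rfl
  | insert j S hj ih =>
    intro k hk hS v hv
    have hmem : iterHomeo (β j) (k j) ∈ VnG n K :=
      Subgroup.subset_closure (Or.inr ⟨β j, k j, hk j, rfl⟩)
    have h2 : (iterHomeo (β j) (k j))⁻¹ * v ∈ VnG n K := by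
      refine ih (Function.update k j 1) ?_ ?_ _ ?_
      · intro i
        by_cases hi : i = j
        · subst hi; simp [K.one_mem]
        · simp [hi, hk]
      · intro i hi
        by_cases hij : i = j
        · subst hij; simp
        · simp [hij]; exact hS i (by simp [hij, hi])
      · intro i γ
        rw [hmul_apply, hv]
        change iterPermFun (β j) (k j)⁻¹ _ = _
        by_cases hij : i = j
        · subst hij
          rw [iter_append]; simp
        · rw [iter_not]
          · simp [hij]
          · intro hc
            exact hij ((hβ _).unique (inCone_appendWord _ _) hc)
    have := mul_mem hmem h2
    rwa [mul_inv_cancel_left] at this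

theorem exists_uniform {n : ℕ} {K : Subgroup (Equiv.Perm (Fin n))} {v : Cantor n → Cantor n}
    (hv : Loc K v) : ∃ N, ∀ x, ∃ M k, k ∈ K ∧ LocAt v x N M k := by
  let P : ℕ → Set (Cantor n) := fun N => {x | ∃ M k, k ∈ K ∧ LocAt v x N M k}
  have hopen : ∀ N, IsOpen (P N) := by
    intro N
    rw [isOpen_iff_mem_nhds]
    rintro x ⟨M, k, hk, h⟩
    have hopen : IsOpen (⋂ i : Fin N, (fun y : Cantor n => y i) ⁻¹' {x i}) :=
      isOpen_iInter_of_finite fun i => (isOpen_discrete _).preimage (continuous_apply _)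
    refine Filter.mem_of_superset (hopen.mem_nhds (by simp)) ?_
    intro y hy
    simp only [Set.mem_iInter, Set.mem_preimage, Set.mem_singleton_iff] at hy
    have hxy : Agree N x y := fun i hi => hy ⟨i, hi⟩
    refine ⟨M, k, hk, fun z hz => ?_⟩
    obtain ⟨a1, a2⟩ := h z (fun i hi => by rw [hz i hi, hxy i hi])
    refine ⟨fun i hi => ?_, a2⟩
    rw [a1 i hi, (h y hxy).1 i hi]
  have hmono : Monotone P := by
    intro N N' hN x
    rintro ⟨M, k, hk, h⟩
    obtain ⟨d, rfl⟩ := Nat.exists_eq_add_of_le hN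
    exact ⟨M + d, k, hk, h.shift d⟩
  obtain ⟨N, hN⟩ := isCompact_univ.elim_directed_cover P hopen
    (fun x _ => by
      obtain ⟨N, M, k, hk, h⟩ := hv x
      exact Set.mem_iUnion.mpr ⟨N, M, k, hk, h⟩) hmono.directed_le
  exact ⟨N, fun x => hN (Set.mem_univ x)⟩

theorem inCone_ofFn {n : ℕ} {m : ℕ} (f : Fin m → Fin n) (x : Cantor n) :
    inCone (List.ofFn f) x ↔ ∀ i : Fin m, x i = f i := by
  constructor
  · intro h i
    have := h i (by simp)
    simpa using this
  · intro h i hi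
    have := h ⟨i, by simpa using hi⟩
    simpa using this

theorem mem_of_loc {n : ℕ} (hn : 2 ≤ n) {K : Subgroup (Equiv.Perm (Fin n))}
    {v : Cantor n ≃ₜ Cantor n} (hv : Loc K v) : v ∈ VnG n K := by
  obtain ⟨N, hN⟩ := exists_uniform hv
  choose M k hk hL using hN
  let t := Fintype.card (Fin N → Fin n)
  let e : Fin t ≃ (Fin N → Fin n) := (Fintype.equivFin _).symm
  let x : Fin t → Cantor n := fun i j => if h : j < N then e i ⟨j, h⟩ else ⟨0, by omega⟩
  have hxe : ∀ i (j : Fin N), x i j = e i j := fun i j => by simp [x]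
  let α : Fin t → List (Fin n) := fun i => List.ofFn (e i)
  let β : Fin t → List (Fin n) := fun i => List.ofFn (fun j : Fin (M (x i)) => v (x i) j)
  have hαl : ∀ i, (α i).length = N := fun i => by simp [α]
  have hβl : ∀ i, (β i).length = M (x i) := fun i => by simp [β]
  have hαc : ∀ i y, inCone (α i) y ↔ Agree N (x i) y := by
    intro i y
    rw [inCone_ofFn]
    exact ⟨fun h j hj => by rw [h ⟨j, hj⟩, hxe i ⟨j, hj⟩], fun h j => by rw [h j j.2, hxe]⟩
  have hβc : ∀ i y, inCone (β i) y ↔ Agree (M (x i)) (v (x i)) y := by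
    intro i y
    rw [inCone_ofFn]
    exact ⟨fun h j hj => h ⟨j, hj⟩, fun h j => h j j.2⟩
  have hα : ∀ y : Cantor n, ∃! i, inCone (α i) y := by
    intro y
    refine ⟨e.symm (fun j => y j), ?_, ?_⟩
    · simp [α, inCone_ofFn]
    · intro i hi
      rw [Equiv.eq_symm_apply]
      funext j
      exact ((inCone_ofFn _ _).1 hi j).symm
  have hmap : ∀ i γ, v (appendWord (α i) γ) = appendWord (β i) (fun j => k (x i) (γ j)) := by
    intro i γ
    obtain ⟨a1, a2⟩ := hL (x i) _ ((hαc i _).1 (inCone_appendWord (α i) γ))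
    rw [eq_appendWord ((hβc i _).2 a1)]
    congr 1
    funext j
    rw [hβl, a2, ← hαl i, appendWord_add]
  have hβ : ∀ y : Cantor n, ∃! i, inCone (β i) y := by
    intro z
    have back : ∀ i, inCone (β i) z → inCone (α i) (v⁻¹ z) := by
      intro i hi
      have h1 : v (appendWord (α i) (fun j => (k (x i))⁻¹ (z ((β i).length + j)))) = z := by
        rw [hmap]
        conv_rhs => rw [eq_appendWord hi]
        simp
      rw [← h1, hinv_apply_self]
      exact inCone_appendWord _ _
    obtain ⟨i, hi, hu⟩ := hα (v⁻¹ z)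
    refine ⟨i, ?_, fun j hj => hu j (back j hj)⟩
    have := (hL (x i) _ ((hαc i _).1 hi)).1
    rw [happly_inv_self] at this
    exact (hβc i _).2 this
  exact mem_of_table α β hα hβ Finset.univ (fun i => k (x i)) (fun i => hk _) (by simp) v hmap

theorem mem_VnG_iff {n : ℕ} (hn : 2 ≤ n) {K : Subgroup (Equiv.Perm (Fin n))}
    {v : Cantor n ≃ₜ Cantor n} : v ∈ VnG n K ↔ Loc K v :=
  ⟨loc_of_mem, mem_of_loc hn⟩

/-- The `H`-component of a letter. -/
theorem exists_comp {n : ℕ} (H : Subgroup (Equiv.Perm (Fin n))) (hH : Semiregular H)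
    (R : Set (Fin n)) (hR : IsTransversal H R)
    (G : Subgroup (Equiv.Perm (Fin n)))
    (hG : G ≤ Subgroup.normalizer (H : Set (Equiv.Perm (Fin n))) ⊓
      MulAction.stabilizer (Equiv.Perm (Fin n)) R) :
    ∃ c : Fin n → Equiv.Perm (Fin n), (∀ a, c a ∈ H) ∧
      (∀ h ∈ H, ∀ a, c (h a) = h * c a) ∧ (∀ g ∈ G, ∀ a, c (g a) = g * c a * g⁻¹) := by
  have h0 : ∀ a, ∃ h ∈ H, h⁻¹ a ∈ R := by
    intro a
    obtain ⟨r, ⟨hr, h, hh, rfl⟩, -⟩ := hR a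
    exact ⟨h⁻¹, H.inv_mem hh, by simpa using hr⟩
  choose c hc hcR using h0
  have uniq : ∀ a, ∀ h ∈ H, h⁻¹ a ∈ R → c a = h := by
    intro a h hh hr
    have := (hR a).unique ⟨hr, h⁻¹, H.inv_mem hh, rfl⟩
      ⟨hcR a, (c a)⁻¹, H.inv_mem (hc a), rfl⟩
    have h1 : c a * h⁻¹ = 1 := by
      refine hH _ (H.mul_mem (hc a) (H.inv_mem hh)) ⟨a, ?_⟩
      rw [Equiv.Perm.mul_apply, this]; simp
    exact mul_inv_eq_one.mp h1
  refine ⟨c, hc, ?_, ?_⟩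
  · intro h hh a
    refine uniq _ _ (H.mul_mem hh (hc a)) ?_
    simpa using hcR a
  · intro g hg a
    obtain ⟨hg1, hg2⟩ := hG hg
    refine uniq _ _ ((Subgroup.mem_normalizer_iff.mp hg1 _).mp (hc a)) ?_
    have : g ((c a)⁻¹ a) ∈ R := by
      have h3 : g • R = R := hg2
      rw [← h3]
      exact Set.smul_mem_smul_set (hcR a)
    simpa [mul_assoc] using this

/-- The conjugating map. -/
def phiFun {n : ℕ} (c : Fin n → Equiv.Perm (Fin n)) (x : Cantor n) : Cantor n
  | 0 => x 0
  | i + 1 => (c (x i))⁻¹ (x (i + 1))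

/-- The inverse of the conjugating map. -/
def psiFun {n : ℕ} (c : Fin n → Equiv.Perm (Fin n)) (y : Cantor n) : Cantor n
  | 0 => y 0
  | i + 1 => c (psiFun c y i) (y (i + 1))

theorem phi_continuous {n : ℕ} (c : Fin n → Equiv.Perm (Fin n)) : Continuous (phiFun c) := by
  refine continuous_pi fun i => ?_
  cases i with
  | zero => exact continuous_apply 0
  | succ i =>
    have : Continuous (fun p : Fin n × Fin n => (c p.1)⁻¹ p.2) := continuous_of_discreteTopology
    have h2 : Continuous (fun x : Cantor n => (x i, x (i + 1))) :=
      (continuous_apply i).prodMk (continuous_apply (i + 1))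
    exact this.comp h2

/-- The conjugating map as an equivalence. -/
def phiEquiv {n : ℕ} (c : Fin n → Equiv.Perm (Fin n)) : Cantor n ≃ Cantor n where
  toFun := phiFun c
  invFun := psiFun c
  left_inv x := by
    funext i
    induction i with
    | zero => rfl
    | succ i ih => simp [psiFun, phiFun, ih]
  right_inv y := by
    funext i
    cases i with
    | zero => rfl
    | succ i => simp [psiFun, phiFun]

/-- The conjugating homeomorphism. -/
noncomputable def phi {n : ℕ} (c : Fin n → Equiv.Perm (Fin n)) : Cantor n ≃ₜ Cantor n :=
  Continuous.homeoOfEquivCompactToT2 (f := phiEquiv c) (phi_continuous c)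

theorem phi_apply {n : ℕ} (c : Fin n → Equiv.Perm (Fin n)) (x : Cantor n) :
    phi c x = phiFun c x := rfl

theorem agree_phi {n : ℕ} {c : Fin n → Equiv.Perm (Fin n)} {N : ℕ} {x y : Cantor n}
    (h : Agree N x y) : Agree N (phiFun c x) (phiFun c y) := by
  intro i hi
  cases i with
  | zero => exact h 0 hi
  | succ i => simp only [phiFun]; rw [h i (by omega), h (i + 1) hi]

theorem agree_of_phi {n : ℕ} {c : Fin n → Equiv.Perm (Fin n)} {N : ℕ} {x y : Cantor n}
    (h : Agree N (phiFun c x) (phiFun c y)) : Agree N x y := by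
  intro i
  induction i with
  | zero => intro hi; exact h 0 hi
  | succ i ih =>
    intro hi
    have h1 := h (i + 1) hi
    simp only [phiFun] at h1
    rw [ih (by omega)] at h1
    exact (Equiv.injective _) h1

theorem vnG_sup_iso_vnG (n : ℕ) (hn : 2 ≤ n)
    (H : Subgroup (Equiv.Perm (Fin n))) (hH : Semiregular H)
    (R : Set (Fin n)) (hR : IsTransversal H R)
    (G : Subgroup (Equiv.Perm (Fin n)))
    (hG : G ≤ Subgroup.normalizer (H : Set (Equiv.Perm (Fin n))) ⊓ MulAction.stabilizer (Equiv.Perm (Fin n)) R) :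
    ((H ⊔ G : Subgroup (Equiv.Perm (Fin n))) : Set (Equiv.Perm (Fin n)))
        = {p | ∃ h ∈ H, ∃ g ∈ G, p = g * h} ∧
      Nonempty (VnG n (H ⊔ G) ≃* VnG n G) := by
  have hset : ((H ⊔ G : Subgroup (Equiv.Perm (Fin n))) : Set (Equiv.Perm (Fin n)))
        = {p | ∃ h ∈ H, ∃ g ∈ G, p = g * h} := by
    rw [sup_comm, Subgroup.coe_mul_of_left_le_normalizer_right G H (hG.trans inf_le_left)]
    ext p
    simp only [Set.mem_mul, SetLike.mem_coe, Set.mem_ofPred_eq]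
    constructor
    · rintro ⟨g, hg, h, hh, rfl⟩
      exact ⟨h, hh, g, hg, rfl⟩
    · rintro ⟨h, hh, g, hg, rfl⟩
      exact ⟨g, hg, h, hh, rfl⟩
  refine ⟨hset, ?_⟩
  obtain ⟨c, hc, hcH, hcG⟩ := exists_comp H hH R hR G hG
  have key : ∀ v u : Cantor n ≃ₜ Cantor n, (∀ x, phi c (v x) = u (phi c x)) →
      (Loc (H ⊔ G) v ↔ Loc G u) := by
    intro v u huv
    simp only [phi_apply] at huv
    constructor
    · intro hv z
      obtain ⟨x, rfl⟩ := (phi c).surjective z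
      obtain ⟨N, M, p, hp, hL⟩ := hv x
      have hp' : p ∈ {p | ∃ h ∈ H, ∃ g ∈ G, p = g * h} := hset ▸ hp
      obtain ⟨h, hh, g, hg, rfl⟩ := hp'
      refine ⟨N + 1, M + 1, g, hg, fun y hy => ?_⟩
      obtain ⟨y, rfl⟩ := (phi c).surjective y
      simp only [phi_apply] at hy ⊢
      rw [← huv, ← huv]
      have hy' := agree_of_phi hy
      refine ⟨agree_phi (hL.shift 1 y hy').1, fun i => ?_⟩
      have h2 := (hL y (fun i hi => hy' i (by omega))).2
      have e1 : M + 1 + i = (M + i) + 1 := by omega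
      have e2 : N + 1 + i = (N + i) + 1 := by omega
      rw [e1, e2]
      simp only [phiFun]
      rw [h2 i, add_assoc M, h2 (i + 1), Equiv.Perm.mul_apply, hcG g hg, hcH h hh]
      simp [add_assoc]
    · intro hu x
      obtain ⟨N, M, g, hg, hL⟩ := hu (phi c x)
      rw [phi_apply] at hL
      have hpc : ∀ h1 ∈ H, ∀ h2 ∈ H, ∀ a, c ((h1 * g * h2⁻¹) a) = (h1 * g * h2⁻¹) * c a * g⁻¹ := by
        intro h1 hh1 h2 hh2 a
        rw [Equiv.Perm.mul_apply, Equiv.Perm.mul_apply, hcH _ hh1, hcG _ hg,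
          hcH _ (H.inv_mem hh2)]
        group
      refine ⟨N + 1, M + 1, c (v x M) * g * (c (x N))⁻¹, ?_, fun y hy => ?_⟩
      · exact mul_mem (mul_mem (Subgroup.mem_sup_left (hc _)) (Subgroup.mem_sup_right hg))
          (inv_mem (Subgroup.mem_sup_left (hc _)))
      · have h1 := hL.shift 1 _ (agree_phi hy)
        rw [← huv, ← huv] at h1
        obtain ⟨a1, a2⟩ := h1
        have a1' := agree_of_phi a1
        refine ⟨a1', ?_⟩
        have hpc' := hpc _ (hc (v x M)) _ (hc (x N))
        set p := c (v x M) * g * (c (x N))⁻¹ with hp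
        have step : ∀ i, c (v y (M + i)) = p * c (y (N + i)) * g⁻¹ →
            v y (M + 1 + i) = p (y (N + 1 + i)) := by
          intro i hi
          have h3 := a2 i
          have e1 : M + 1 + i = (M + i) + 1 := by omega
          have e2 : N + 1 + i = (N + i) + 1 := by omega
          rw [e1, e2] at h3 ⊢
          simp only [phiFun] at h3
          rw [Equiv.Perm.inv_eq_iff_eq, hi] at h3
          rw [h3]
          simp
        have ind : ∀ i, c (v y (M + i)) = p * c (y (N + i)) * g⁻¹ := by
          intro i
          induction i with
          | zero =>
            rw [add_zero, add_zero, a1' M (by omega), hy N (by omega), hp]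
            group
          | succ i ih =>
            have h4 := step i ih
            have e1 : M + 1 + i = M + (i + 1) := by omega
            have e2 : N + 1 + i = N + (i + 1) := by omega
            rw [e1, e2] at h4
            rw [h4, hpc']
        exact fun i => step i (ind i)
  have hmap : (VnG n (H ⊔ G)).map (MulAut.conj (phi c)).toMonoidHom = VnG n G := by
    ext u
    rw [Subgroup.mem_map]
    constructor
    · rintro ⟨v, hv, rfl⟩
      rw [mem_VnG_iff hn] at hv ⊢
      refine (key v _ fun x => ?_).1 hv
      change _ = phi c (v ((phi c)⁻¹ (phi c x)))
      rw [hinv_apply_self]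
    · intro hu
      refine ⟨(phi c)⁻¹ * u * phi c, ?_, ?_⟩
      · rw [mem_VnG_iff hn] at hu ⊢
        refine (key _ u fun x => ?_).2 hu
        rw [hmul_apply, hmul_apply, happly_inv_self]
      · change phi c * ((phi c)⁻¹ * u * phi c) * (phi c)⁻¹ = u
        group
  exact ⟨((MulAut.conj (phi c)).subgroupMap (VnG n (H ⊔ G))).trans
    (MulEquiv.subgroupCongr hmap)⟩
end

section
/- Let H ≤ S_n be semiregular, let R be an orbit transversal of H, and let G ≤ N_{S_n}(H) ∩ Stab_{S_n}(R). Then for all h ∈ H, g ∈ G, and x ∈ {1,…,n}, one has h_x^{-1}·(hg)·h_{x·(hg)} = g. -/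
open scoped Classical Pointwise

/-- `hmap` assigns to each letter `i` the (unique) element `h_i` of `H` with
`i ⬝ h_i ∈ R`. -/
def IsHmap {n : ℕ} (H : Subgroup (Equiv.Perm (Fin n))) (R : Set (Fin n))
    (hmap : Fin n → Equiv.Perm (Fin n)) : Prop :=
  ∀ i : Fin n, hmap i ∈ H ∧ hmap i i ∈ R

/-- Let `H ≤ S_n` be semiregular with orbit transversal `R` and
`G ≤ N_{S_n}(H) ⊓ Stab_{S_n}(R)`.  Then for `h ∈ H`, `g ∈ G` and every point
`x`, one has `h_x⁻¹ ⬝ (hg) ⬝ h_{x⬝(hg)} = g`.  (Products are left-to-right, so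
this reads `hmap (x⬝hg) * (g * h) * (hmap x)⁻¹ = g` in Mathlib's convention,
with `x ⬝ hg = g (h x)`.) -/
theorem hmap_twisted_conj (n : ℕ)
    (H : Subgroup (Equiv.Perm (Fin n))) (hH : Semiregular H)
    (R : Set (Fin n)) (hR : IsTransversal H R)
    (G : Subgroup (Equiv.Perm (Fin n)))
    (hG : G ≤ Subgroup.normalizer (H : Set (Equiv.Perm (Fin n))) ⊓ MulAction.stabilizer (Equiv.Perm (Fin n)) R)
    (hmap : Fin n → Equiv.Perm (Fin n)) (hhmap : IsHmap H R hmap)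
    (h g : Equiv.Perm (Fin n)) (hh : h ∈ H) (hg : g ∈ G) (x : Fin n) :
    hmap (g (h x)) * (g * h) * (hmap x)⁻¹ = g := by
  obtain ⟨hN, hS⟩ := hG hg
  have hk : hmap (g (h x)) * (g * (h * (hmap x)⁻¹) * g⁻¹) ∈ H :=
    H.mul_mem (hhmap _).1 ((Subgroup.mem_normalizer_iff.1 hN _).1
      (H.mul_mem hh (H.inv_mem (hhmap x).1)))
  have hgr : g (hmap x x) ∈ R := by
    have h1 : g • R = R := hS
    have h2 : g • (hmap x x) ∈ g • R := Set.smul_mem_smul_set (hhmap x).2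
    rw [h1] at h2
    exact h2
  have hkr : (hmap (g (h x)) * (g * (h * (hmap x)⁻¹) * g⁻¹)) (g (hmap x x))
      = hmap (g (h x)) (g (h x)) := by
    simp [Equiv.Perm.mul_apply]
  have hfix := (hR (g (hmap x x))).unique
    ⟨(hhmap (g (h x))).2, _, hk, hkr⟩ ⟨hgr, 1, H.one_mem, rfl⟩
  have h1 := hH _ hk ⟨_, hkr.trans hfix⟩
  calc hmap (g (h x)) * (g * h) * (hmap x)⁻¹
      = (hmap (g (h x)) * (g * (h * (hmap x)⁻¹) * g⁻¹)) * g := by group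
    _ = g := by rw [h1, one_mul]
end
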